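/- arXiv:1807.06848 — 9 statements merged into one kernel-verified Lean document; each statement's English description precedes it below -/
import Mathlib

section
/- Let (z,w) ∈ ℂ² and define J₁,J₂,J₃,K₁,K₂,K₃,L₁,L₂,L₃ and E as the so(3,2) generators: J₃ = (|z|² − |w|²)/2, J₁ = (conj(z)·w + z·conj(w))/2, J₂ = (conj(z)·w − z·conj(w))/(2i); K₃ = −(conj(z)·conj(w) + z·w)/2, K₁ = ((conj(z)² − w²)/2 + (z² − conj(w)²)/2)/2, K₂ = ((conj(z)² − w²)/2 − (z² − conj(w)²)/2)/(2i); L₃ = (i/2)(conj(z)·conj(w) − z·w), L₁ = (−(i/2)(conj(z)² + w²) + (i/2)(z² + conj(w)²))/2, L₂ = (−(i/2)(conj(z)² + w²) − (i/2)(z² + conj(w)²))/(2i); E = (|z|² + |w|²)/2. Then for each index a ∈ {1,2,3} one has the identity J_a² + K_a² + L_a² = E². In particular, when E ≠ 0 the 3×3 real matrix with columns J⃗/E, K⃗/E, L⃗/E is an orthogonal matrix. -/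
open Complex ComplexConjugate Matrix

/-- Componentwise identities `J_a² + K_a² + L_a² = E²` for the so(3,2) generators,
and orthogonality of the 3×3 matrix with columns `J⃗/E, K⃗/E, L⃗/E` when `E ≠ 0`. -/
theorem stmt_4 (z w : ℂ)
    (J₁ J₂ J₃ K₁ K₂ K₃ L₁ L₂ L₃ E : ℂ)
    (hJ3 : J₃ = (conj z * z - conj w * w) / 2)
    (hJ1 : J₁ = (conj z * w + z * conj w) / 2)
    (hJ2 : J₂ = (conj z * w - z * conj w) / (2 * Complex.I))
    (hK3 : K₃ = -(conj z * conj w + z * w) / 2)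
    (hK1 : K₁ = (((conj z) ^ 2 - w ^ 2) / 2 + (z ^ 2 - (conj w) ^ 2) / 2) / 2)
    (hK2 : K₂ = (((conj z) ^ 2 - w ^ 2) / 2 - (z ^ 2 - (conj w) ^ 2) / 2) / (2 * Complex.I))
    (hL3 : L₃ = (Complex.I / 2) * (conj z * conj w - z * w))
    (hL1 : L₁ = (-(Complex.I / 2) * ((conj z) ^ 2 + w ^ 2)
      + (Complex.I / 2) * (z ^ 2 + (conj w) ^ 2)) / 2)
    (hL2 : L₂ = (-(Complex.I / 2) * ((conj z) ^ 2 + w ^ 2)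
      - (Complex.I / 2) * (z ^ 2 + (conj w) ^ 2)) / (2 * Complex.I))
    (hE : E = (conj z * z + conj w * w) / 2) :
    (J₁ ^ 2 + K₁ ^ 2 + L₁ ^ 2 = E ^ 2) ∧
    (J₂ ^ 2 + K₂ ^ 2 + L₂ ^ 2 = E ^ 2) ∧
    (J₃ ^ 2 + K₃ ^ 2 + L₃ ^ 2 = E ^ 2) ∧
    (E ≠ 0 →
      (!![J₁ / E, K₁ / E, L₁ / E;
          J₂ / E, K₂ / E, L₂ / E;
          J₃ / E, K₃ / E, L₃ / E] : Matrix (Fin 3) (Fin 3) ℂ)ᵀ *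
        !![J₁ / E, K₁ / E, L₁ / E;
           J₂ / E, K₂ / E, L₂ / E;
           J₃ / E, K₃ / E, L₃ / E] = 1) := by
  have hI : Complex.I ^ 2 = -1 := Complex.I_sq
  have hdiv (x : ℂ) : x / (2 * Complex.I) = -(Complex.I / 2) * x := by
    rw [div_eq_iff (by simp)]
    linear_combination x * hI
  rw [hdiv] at hJ2 hK2 hL2
  generalize conj z = a at *
  generalize conj w = b at *
  generalize Complex.I = i at *
  have hi3 : i ^ 3 = -i := by linear_combination i * hI
  have hi4 : i ^ 4 = 1 := by linear_combination (i ^ 2 - 1) * hI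
  have hJJ : J₁ * J₁ + J₂ * J₂ + J₃ * J₃ = E * E := by
    subst_vars; ring_nf; simp only [hI]; ring
  have hKK : K₁ * K₁ + K₂ * K₂ + K₃ * K₃ = E * E := by
    subst_vars; ring_nf; simp only [hI]; ring
  have hLL : L₁ * L₁ + L₂ * L₂ + L₃ * L₃ = E * E := by
    subst_vars; ring_nf; simp only [hI, hi4]; ring
  have hJK : J₁ * K₁ + J₂ * K₂ + J₃ * K₃ = 0 := by
    subst_vars; ring_nf; simp only [hI]; ring
  have hJL : J₁ * L₁ + J₂ * L₂ + J₃ * L₃ = 0 := by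
    subst_vars; ring_nf; simp only [hi3]; ring
  have hKL : K₁ * L₁ + K₂ * L₂ + K₃ * L₃ = 0 := by
    subst_vars; ring_nf; simp only [hi3]; ring
  refine ⟨?_, ?_, ?_, fun hE0 => ?_⟩
  · subst_vars; ring_nf; simp only [hI]; ring
  · subst_vars; ring_nf; simp only [hI, hi4]; ring
  · subst_vars; ring_nf; simp only [hI]; ring
  · clear hJ1 hJ2 hJ3 hK1 hK2 hK3 hL1 hL2 hL3 hE
    ext r c
    fin_cases r <;> fin_cases c <;>
      simp [Matrix.mul_apply, Fin.sum_univ_three] <;> field_simp <;>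
      first
      | linear_combination hJJ
      | linear_combination hKK
      | linear_combination hLL
      | linear_combination hJK
      | linear_combination hJL
      | linear_combination hKL
end

section
/- Let N ≥ 1, let u, t ∈ ℂᴺ and E ∈ ℝ satisfy the closure constraints Σⱼ uⱼ·tⱼ = 0 and Σⱼ uⱼ·conj(tⱼ) = i·E. Define the N×N matrix Δ by Δⱼₖ = 2i·(conj(uⱼ)·tₖ − uⱼ·conj(tₖ)). Then: (1) every entry Δⱼₖ is real (indeed Δⱼₖ = 4·Im(uⱼ·conj(tₖ))); (2) trace(Δ) = 4E; (3) Δ·Δ = 2E·Δ. -/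
open Complex ComplexConjugate Matrix

/-- Properties of the deformation matrix `Δⱼₖ = 2i(conj(uⱼ)tₖ − uⱼ conj(tₖ))` for a
closed configuration with total area `E`: entries are real (equal to
`4·Im(uⱼ conj(tₖ))`), `tr Δ = 4E`, and `Δ² = 2E·Δ`. -/
theorem stmt_9 (N : ℕ) (hN : 1 ≤ N) (u t : Fin N → ℂ) (E : ℝ)
    (hc1 : ∑ j, u j * t j = 0)
    (hc2 : ∑ j, u j * conj (t j) = Complex.I * E)
    (Δ : Matrix (Fin N) (Fin N) ℂ)
    (hΔ : ∀ j k, Δ j k = 2 * Complex.I * (conj (u j) * t k - u j * conj (t k))) :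
    (∀ j k, (Δ j k).im = 0) ∧
    (∀ j k, Δ j k = ((4 * (u j * conj (t k)).im : ℝ) : ℂ)) ∧
    Δ.trace = ((4 * E : ℝ) : ℂ) ∧
    Δ * Δ = ((2 * E : ℝ) : ℂ) • Δ := by
  have hreal : ∀ j k, Δ j k = ((4 * (u j * conj (t k)).im : ℝ) : ℂ) := fun j k => by
    rw [hΔ]
    apply Complex.ext <;> simp <;> ring
  have hc1' : ∑ j, conj (u j) * conj (t j) = 0 := by
    simpa using congrArg conj hc1
  have hc2' : ∑ j, conj (u j) * t j = -(Complex.I * E) := by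
    simpa using congrArg conj hc2
  refine ⟨fun j k => ?_, hreal, ?_, ?_⟩
  · rw [hreal, Complex.ofReal_im]
  · simp only [Matrix.trace, Matrix.diag_apply, hΔ]
    rw [← Finset.mul_sum, Finset.sum_sub_distrib, hc2, hc2']
    push_cast
    linear_combination (-4 * (E : ℂ)) * Complex.I_sq
  · ext j k
    have hexpand : (Δ * Δ) j k = (2 * Complex.I) ^ 2 *
        (conj (u j) * t k * ∑ l, conj (u l) * t l - conj (u j) * conj (t k) * ∑ l, u l * t l
          - u j * t k * ∑ l, conj (u l) * conj (t l)
          + u j * conj (t k) * ∑ l, u l * conj (t l)) := by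
      simp only [Matrix.mul_apply, hΔ, Finset.mul_sum, ← Finset.sum_sub_distrib,
        ← Finset.sum_add_distrib]
      exact Finset.sum_congr rfl fun l _ => by ring
    rw [hexpand, hc1, hc1', hc2, hc2', Matrix.smul_apply, hΔ, smul_eq_mul]
    push_cast
    linear_combination
      (-4 * Complex.I * E * (conj (u j) * t k - u j * conj (t k))) * Complex.I_sq
end

section
/- Let N ≥ 1, let u, t ∈ ℂᴺ and E ∈ ℝ satisfy the closure constraints Σⱼ uⱼ·tⱼ = 0 and Σⱼ uⱼ·conj(tⱼ) = i·E. Define the N×N matrices Δⱼₖ = 2i·(conj(uⱼ)·tₖ − uⱼ·conj(tₖ)) and Θⱼₖ = 2·(conj(uⱼ)·tₖ + uⱼ·conj(tₖ)). Then: (1) every entry Θⱼₖ is real (Θⱼₖ = 4·Re(uⱼ·conj(tₖ))); (2) trace(Θ) = 0; (3) Δ·Θ = Θ·Δ = 2E·Θ; (4) Θ·Θ = −2E·Δ. -/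
open Complex ComplexConjugate Matrix

/-- Under the closure constraints, the pairing of a combination of `t, conj t` with a combination
of `conj u, u` only depends on the total area. -/
theorem sum_mul_of_closure {ι : Type*} [Fintype ι] {u t : ι → ℂ} {E : ℝ}
    (hc1 : ∑ j, u j * t j = 0) (hc2 : ∑ j, u j * conj (t j) = Complex.I * E) (a b c d : ℂ) :
    ∑ k, (a * t k + b * conj (t k)) * (conj (u k) * c + u k * d) =
      Complex.I * E * (b * d - a * c) := by
  have hc1' : ∑ j, conj (u j) * conj (t j) = 0 := by
    simpa using congrArg conj hc1
  have hc2' : ∑ j, conj (u j) * t j = -(Complex.I * E) := by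
    simpa using congrArg conj hc2
  calc ∑ k, (a * t k + b * conj (t k)) * (conj (u k) * c + u k * d)
      = a * c * ∑ k, conj (u k) * t k + a * d * ∑ k, u k * t k
        + b * c * ∑ k, conj (u k) * conj (t k) + b * d * ∑ k, u k * conj (t k) := by
        simp only [Finset.mul_sum, ← Finset.sum_add_distrib]
        exact Finset.sum_congr rfl fun k _ => by ring
    _ = Complex.I * E * (b * d - a * c) := by
        rw [hc1, hc2, hc1', hc2']; ring

/-- Properties of `Θⱼₖ = 2(conj(uⱼ)tₖ + uⱼ conj(tₖ))` for a closed configuration with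
total area `E`: entries are real (equal to `4·Re(uⱼ conj(tₖ))`), `tr Θ = 0`,
`ΔΘ = ΘΔ = 2E·Θ` and `Θ² = −2E·Δ`. -/
theorem stmt_11 (N : ℕ) (hN : 1 ≤ N) (u t : Fin N → ℂ) (E : ℝ)
    (hc1 : ∑ j, u j * t j = 0)
    (hc2 : ∑ j, u j * conj (t j) = Complex.I * E)
    (Δ Θ : Matrix (Fin N) (Fin N) ℂ)
    (hΔ : ∀ j k, Δ j k = 2 * Complex.I * (conj (u j) * t k - u j * conj (t k)))
    (hΘ : ∀ j k, Θ j k = 2 * (conj (u j) * t k + u j * conj (t k))) :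
    (∀ j k, (Θ j k).im = 0) ∧
    (∀ j k, Θ j k = ((4 * (u j * conj (t k)).re : ℝ) : ℂ)) ∧
    Θ.trace = 0 ∧
    Δ * Θ = ((2 * E : ℝ) : ℂ) • Θ ∧
    Θ * Δ = ((2 * E : ℝ) : ℂ) • Θ ∧
    Θ * Θ = ((-(2 * E) : ℝ) : ℂ) • Δ := by
  have hre : ∀ j k, Θ j k = ((4 * (u j * conj (t k)).re : ℝ) : ℂ) := fun j k => by
    rw [hΘ]
    apply Complex.ext <;> simp <;> ring
  refine ⟨fun j k => by rw [hre, Complex.ofReal_im], hre, ?_, ?_, ?_, ?_⟩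
  · have h : ∑ j, (u j * conj (t j)).re = 0 := by
      rw [← Complex.re_sum, hc2]; simp
    simp only [Matrix.trace, Matrix.diag_apply, hre]
    rw [← Complex.ofReal_sum, ← Finset.mul_sum, h]
    simp
  · ext j l
    have h := sum_mul_of_closure hc1 hc2 (2 * Complex.I * conj (u j)) (-(2 * Complex.I * u j))
      (2 * t l) (2 * conj (t l))
    simp only [Matrix.mul_apply, Matrix.smul_apply, smul_eq_mul, hΔ, hΘ]
    push_cast
    refine (Finset.sum_congr rfl fun k _ => ?_).trans (h.trans ?_)
    · ring
    · linear_combination (-4 * E * (conj (u j) * t l + u j * conj (t l))) * Complex.I_sq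
  · ext j l
    have h := sum_mul_of_closure hc1 hc2 (2 * conj (u j)) (2 * u j)
      (2 * Complex.I * t l) (-(2 * Complex.I * conj (t l)))
    simp only [Matrix.mul_apply, Matrix.smul_apply, smul_eq_mul, hΔ, hΘ]
    push_cast
    refine (Finset.sum_congr rfl fun k _ => ?_).trans (h.trans ?_)
    · ring
    · linear_combination (-4 * E * (conj (u j) * t l + u j * conj (t l))) * Complex.I_sq
  · ext j l
    have h := sum_mul_of_closure hc1 hc2 (2 * conj (u j)) (2 * u j)
      (2 * t l) (2 * conj (t l))
    simp only [Matrix.mul_apply, Matrix.smul_apply, smul_eq_mul, hΔ, hΘ]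
    push_cast
    refine (Finset.sum_congr rfl fun k _ => ?_).trans (h.trans ?_)
    · ring
    · ring
end

section
/- Let N ≥ 2, let E > 0 be real, and let u, t ∈ ℂᴺ satisfy the closure constraints Σⱼ uⱼ·tⱼ = 0 and Σⱼ uⱼ·conj(tⱼ) = i·E. Then there exists an invertible N×N real matrix M such that, with M̃ = transpose(M⁻¹), for every index i one has tᵢ = √(E/2)·(M_{i2} − i·M_{i1}) and uᵢ = √(E/2)·(M̃_{i1} + i·M̃_{i2}). Equivalently, every closed configuration with total area E > 0 is the image under the GL_N(ℝ) action (t ↦ M·t, u ↦ transpose(M)⁻¹·u) of the totally squashed configuration (u⁰₁,t⁰₁) = √(E/2)·(1,−i), (u⁰₂,t⁰₂) = √(E/2)·(i,1), (u⁰ⱼ,t⁰ⱼ) = (0,0) for j ≥ 3, which itself satisfies the closure constraints with total area E. -/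
open Complex ComplexConjugate Matrix

/-- There are `n` linearly independent vectors of `K ^ (n + 2)` orthogonal to two given ones. -/
lemma exists_linearIndependent_dotProduct_eq_zero {K : Type*} [Field K] {n : ℕ}
    (c d : Fin (n + 2) → K) :
    ∃ k : Fin n → Fin (n + 2) → K, LinearIndependent K k ∧
      (∀ m, c ⬝ᵥ k m = 0) ∧ ∀ m, d ⬝ᵥ k m = 0 := by
  let L : (Fin (n + 2) → K) →ₗ[K] (Fin 2 → K) := (Matrix.of ![c, d]).mulVecLin
  have hle : n ≤ Module.finrank K (LinearMap.ker L) := by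
    have h := L.finrank_range_add_finrank_ker
    have h' := (LinearMap.range L).finrank_le
    simp only [Module.finrank_fin_fun] at h h'
    omega
  obtain ⟨f, hf⟩ := exists_linearIndependent_of_le_finrank hle
  have hker (m : Fin n) : L (f m) = 0 := (f m).2
  refine ⟨fun m => f m, hf.map' (LinearMap.ker L).subtype (Submodule.ker_subtype _),
    fun m => ?_, fun m => ?_⟩
  · exact congrFun (hker m) 0
  · exact congrFun (hker m) 1

/-- Two biorthogonal pairs of vectors extend to the first two columns of an invertible matrix
and the first two rows of its inverse. -/
lemma exists_isUnit_det_of_biorthogonal {K : Type*} [Field K] {n : ℕ}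
    {a b c d : Fin (n + 2) → K} (hca : c ⬝ᵥ a = 1) (hcb : c ⬝ᵥ b = 0)
    (hda : d ⬝ᵥ a = 0) (hdb : d ⬝ᵥ b = 1) :
    ∃ M : Matrix (Fin (n + 2)) (Fin (n + 2)) K, IsUnit M.det ∧
      (∀ i, M i 0 = a i) ∧ (∀ i, M i 1 = b i) ∧
      (∀ i, M⁻¹ 0 i = c i) ∧ ∀ i, M⁻¹ 1 i = d i := by
  obtain ⟨k, hk, hck, hdk⟩ := exists_linearIndependent_dotProduct_eq_zero c d
  let M : Matrix (Fin (n + 2)) (Fin (n + 2)) K := (Matrix.of (vecCons a (vecCons b k)))ᵀ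
  have hcM : c ᵥ* M = Pi.single 0 1 := by
    ext j
    refine Fin.cases ?_ (fun j => Fin.cases ?_ (fun m => ?_) j) j
    · exact hca.trans (by simp)
    · exact hcb.trans (by simp)
    · exact (hck m).trans (by simp)
  have hdM : d ᵥ* M = Pi.single 1 1 := by
    ext j
    refine Fin.cases ?_ (fun j => Fin.cases ?_ (fun m => ?_) j) j
    · exact hda.trans (by simp)
    · exact hdb.trans (by simp)
    · have h : (m.succ.succ : Fin (n + 2)) ≠ 1 := by simp [Fin.ext_iff]
      rw [Pi.single_eq_of_ne h]
      exact hdk m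
  have hM : IsUnit M := by
    rw [← Matrix.mulVec_injective_iff_isUnit]
    refine (injective_iff_map_eq_zero M.mulVecLin).2 fun x hx => ?_
    replace hx : M *ᵥ x = 0 := hx
    have h0 : x 0 = 0 := by
      have h := dotProduct_mulVec c M x
      rw [hx, hcM] at h
      simpa using h.symm
    have h1 : x 1 = 0 := by
      have h := dotProduct_mulVec d M x
      rw [hx, hdM] at h
      simpa using h.symm
    have hs : ∑ m : Fin n, x m.succ.succ • k m = 0 := by
      ext i
      have h := congrFun hx i
      rw [mulVec, dotProduct, Fin.sum_univ_succ, Fin.sum_univ_succ] at h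
      simpa [M, h0, h1, mul_comm] using h
    have hz := Fintype.linearIndependent_iff.1 hk _ hs
    ext j
    exact Fin.cases h0 (fun j => Fin.cases h1 hz j) j
  have hdet := (Matrix.isUnit_iff_isUnit_det M).1 hM
  have hinv (v : Fin (n + 2) → K) : v ᵥ* M ᵥ* M⁻¹ = v := by
    rw [vecMul_vecMul, mul_nonsing_inv _ hdet, vecMul_one]
  refine ⟨M, hdet, fun i => rfl, fun i => rfl, fun i => ?_, fun i => ?_⟩
  · simpa [hcM] using congrFun (hinv c) i
  · simpa [hdM] using congrFun (hinv d) i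

/-- Proposition 2 (cyclicity of the GL_N(ℝ) action): every closed configuration with
total area `E > 0` is the image under the GL_N(ℝ) action of the totally squashed
configuration `(u⁰₁,t⁰₁) = √(E/2)(1,−i)`, `(u⁰₂,t⁰₂) = √(E/2)(i,1)`, `(u⁰ⱼ,t⁰ⱼ) = 0`
for `j ≥ 3`, which itself satisfies the closure constraints with total area `E`. -/
theorem stmt_12 (N : ℕ) (hN : 2 ≤ N) (E : ℝ) (hE : 0 < E) (u t : Fin N → ℂ)
    (hc1 : ∑ j, u j * t j = 0)
    (hc2 : ∑ j, u j * conj (t j) = Complex.I * E)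
    (u0 t0 : Fin N → ℂ)
    (hu0 : ∀ j, u0 j = if j = (⟨0, by omega⟩ : Fin N) then (Real.sqrt (E / 2) : ℂ)
      else if j = (⟨1, by omega⟩ : Fin N) then Complex.I * (Real.sqrt (E / 2) : ℂ) else 0)
    (ht0 : ∀ j, t0 j = if j = (⟨0, by omega⟩ : Fin N) then -Complex.I * (Real.sqrt (E / 2) : ℂ)
      else if j = (⟨1, by omega⟩ : Fin N) then (Real.sqrt (E / 2) : ℂ) else 0) :
    ((∑ j, u0 j * t0 j = 0) ∧ (∑ j, u0 j * conj (t0 j) = Complex.I * E)) ∧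
    ∃ M : Matrix (Fin N) (Fin N) ℝ, IsUnit M.det ∧
      (∀ i, t i = (Real.sqrt (E / 2) : ℂ) *
        ((M i ⟨1, by omega⟩ : ℝ) - Complex.I * (M i ⟨0, by omega⟩ : ℝ))) ∧
      (∀ i, u i = (Real.sqrt (E / 2) : ℂ) *
        (((M⁻¹)ᵀ i ⟨0, by omega⟩ : ℝ) + Complex.I * ((M⁻¹)ᵀ i ⟨1, by omega⟩ : ℝ))) ∧
      t = (M.map Complex.ofReal).mulVec t0 ∧
      u = (((M⁻¹)ᵀ).map Complex.ofReal).mulVec u0 := by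
  obtain ⟨n, rfl⟩ := Nat.exists_eq_add_of_le' hN
  have hz : (⟨0, by omega⟩ : Fin (n + 2)) = 0 := rfl
  have ho : (⟨1, by omega⟩ : Fin (n + 2)) = 1 := rfl
  simp only [hz, ho] at hu0 ht0 ⊢
  set s : ℝ := Real.sqrt (E / 2)
  have hs0 : 0 < s := Real.sqrt_pos.2 (by positivity)
  have hss : s * s = E / 2 := Real.mul_self_sqrt (by positivity)
  have hssC : (s : ℂ) * s = E / 2 := by exact_mod_cast hss
  have hu00 : u0 0 = s := by simp [hu0]
  have hu01 : u0 1 = I * s := by simp [hu0]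
  have hu0s (m : Fin n) : u0 m.succ.succ = 0 := by simp [hu0, Fin.ext_iff]
  have ht00 : t0 0 = -I * s := by simp [ht0]
  have ht01 : t0 1 = s := by simp [ht0]
  have ht0s (m : Fin n) : t0 m.succ.succ = 0 := by simp [ht0, Fin.ext_iff]
  refine ⟨⟨?_, ?_⟩, ?_⟩
  · simp only [Fin.sum_univ_succ, hu0s, Fin.succ_zero_eq_one, hu00, hu01, ht00, ht01]
    simp
    ring
  · simp only [Fin.sum_univ_succ, hu0s, Fin.succ_zero_eq_one, hu00, hu01, ht00, ht01]
    simp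
    linear_combination 2 * I * hssC
  have r1 := congrArg Complex.re hc1
  have i1 := congrArg Complex.im hc1
  have r2 := congrArg Complex.re hc2
  have i2 := congrArg Complex.im hc2
  simp only [Complex.re_sum, Complex.im_sum, Complex.mul_re, Complex.mul_im, Complex.conj_re,
    Complex.conj_im, Complex.I_re, Complex.I_im, Complex.ofReal_re, Complex.ofReal_im,
    Complex.zero_re, Complex.zero_im, Finset.sum_add_distrib, Finset.sum_sub_distrib,
    mul_neg, Finset.sum_neg_distrib] at r1 i1 r2 i2
  have hdot (f g : Fin (n + 2) → ℝ) :
      (fun j => f j / s) ⬝ᵥ (fun j => g j / s) = (∑ j, f j * g j) / (E / 2) := by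
    simp only [dotProduct, Finset.sum_div, ← hss, div_mul_div_comm]
  obtain ⟨M, hM, hM0, hM1, hI0, hI1⟩ := exists_isUnit_det_of_biorthogonal
    (a := fun j => -(t j).im / s) (b := fun j => (t j).re / s)
    (c := fun j => (u j).re / s) (d := fun j => (u j).im / s)
    (by rw [hdot, div_eq_one_iff_eq (by positivity)]
        simp only [mul_neg, Finset.sum_neg_distrib]; linarith)
    (by rw [hdot, div_eq_zero_iff]; left; linarith)
    (by rw [hdot, div_eq_zero_iff]; left
        simp only [mul_neg, Finset.sum_neg_distrib]; linarith)
    (by rw [hdot, div_eq_one_iff_eq (by positivity)]; linarith)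
  have ht (i : Fin (n + 2)) : t i = (s : ℂ) * ((M i 1 : ℝ) - I * (M i 0 : ℝ)) := by
    rw [hM0, hM1]
    apply Complex.ext <;> simp <;> field_simp
  have hu (i : Fin (n + 2)) :
      u i = (s : ℂ) * (((M⁻¹)ᵀ i 0 : ℝ) + I * ((M⁻¹)ᵀ i 1 : ℝ)) := by
    rw [transpose_apply, transpose_apply, hI0, hI1]
    apply Complex.ext <;> simp <;> field_simp
  refine ⟨M, hM, ht, hu, ?_, ?_⟩
  · ext i
    rw [ht i, mulVec, dotProduct]
    simp only [Fin.sum_univ_succ, ht0s, Fin.succ_zero_eq_one, ht00, ht01, map_apply, mul_zero,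
      Finset.sum_const_zero]
    ring
  · ext i
    rw [hu i, mulVec, dotProduct]
    simp only [Fin.sum_univ_succ, hu0s, Fin.succ_zero_eq_one, hu00, hu01, map_apply, mul_zero,
      Finset.sum_const_zero]
    ring
end

section
/- Let N ≥ 2, let E > 0 be real, and let (u⁰,t⁰) ∈ ℂᴺ×ℂᴺ be the totally squashed configuration: u⁰₁ = √(E/2), t⁰₁ = −i·√(E/2), u⁰₂ = i·√(E/2), t⁰₂ = √(E/2), and u⁰ⱼ = t⁰ⱼ = 0 for j ≥ 3. Let M be an invertible N×N real matrix. Then M·t⁰ = t⁰ and transpose(M⁻¹)·u⁰ = u⁰ hold if and only if M_{i1} = δ_{i1}, M_{i2} = δ_{i2}, M_{1j} = δ_{1j} and M_{2j} = δ_{2j} for all i, j, i.e. M is block-diagonal of the form M = I₂ ⊕ Q with Q an arbitrary invertible (N−2)×(N−2) real matrix. In particular the stabilizer of the squashed configuration in GL_N(ℝ) is isomorphic to GL_{N−2}(ℝ). -/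
open Complex ComplexConjugate Matrix

/-- A real matrix fixes a complex vector iff it fixes its real and imaginary parts. -/
theorem map_ofReal_mulVec_eq_self_iff {n : Type*} [Fintype n] (A : Matrix n n ℝ) (w : n → ℂ) :
    (A.map Complex.ofReal).mulVec w = w ↔
      (A.mulVec (fun i => (w i).re) = fun i => (w i).re) ∧
        (A.mulVec (fun i => (w i).im) = fun i => (w i).im) := by
  simp only [funext_iff, Complex.ext_iff, ← forall_and]
  simp [Matrix.mulVec, dotProduct]

theorem mulVec_single_eq_self_iff {n : Type*} [Fintype n] [DecidableEq n] (A : Matrix n n ℝ)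
    (j : n) {c : ℝ} (hc : c ≠ 0) :
    A.mulVec (Pi.single j c) = Pi.single j c ↔ ∀ i, A i j = if i = j then 1 else 0 := by
  rw [funext_iff]
  refine forall_congr' fun i => ?_
  by_cases h : i = j <;> simp [h, hc]

theorem nonsing_inv_mulVec_eq_self_iff {n : Type*} [Fintype n] [DecidableEq n]
    (A : Matrix n n ℝ) (hA : IsUnit A.det) (v : n → ℝ) :
    A⁻¹.mulVec v = v ↔ A.mulVec v = v := by
  constructor <;> intro h
  · conv_lhs => rw [← h]
    rw [Matrix.mulVec_mulVec, Matrix.mul_nonsing_inv _ hA, Matrix.one_mulVec]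
  · conv_lhs => rw [← h]
    rw [Matrix.mulVec_mulVec, Matrix.nonsing_inv_mul _ hA, Matrix.one_mulVec]

/-- Stabilizer of the totally squashed configuration: an invertible real matrix `M`
fixes `(u⁰,t⁰)` under the GL_N(ℝ) action iff its first two columns and first two rows
are the corresponding Kronecker deltas, i.e. `M = I₂ ⊕ Q` with `Q` invertible; hence
the stabilizer is isomorphic to `GL_{N−2}(ℝ)`. -/
theorem stmt_13 (N : ℕ) (hN : 2 ≤ N) (E : ℝ) (hE : 0 < E)
    (u0 t0 : Fin N → ℂ)
    (hu0 : ∀ j, u0 j = if j = (⟨0, by omega⟩ : Fin N) then (Real.sqrt (E / 2) : ℂ)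
      else if j = (⟨1, by omega⟩ : Fin N) then Complex.I * (Real.sqrt (E / 2) : ℂ) else 0)
    (ht0 : ∀ j, t0 j = if j = (⟨0, by omega⟩ : Fin N) then -Complex.I * (Real.sqrt (E / 2) : ℂ)
      else if j = (⟨1, by omega⟩ : Fin N) then (Real.sqrt (E / 2) : ℂ) else 0)
    (M : Matrix (Fin N) (Fin N) ℝ) (hM : IsUnit M.det) :
    ((M.map Complex.ofReal).mulVec t0 = t0 ∧
     (((Mᵀ)⁻¹).map Complex.ofReal).mulVec u0 = u0) ↔
      ((∀ i, M i ⟨0, by omega⟩ = if i = (⟨0, by omega⟩ : Fin N) then 1 else 0) ∧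
       (∀ i, M i ⟨1, by omega⟩ = if i = (⟨1, by omega⟩ : Fin N) then 1 else 0) ∧
       (∀ j, M ⟨0, by omega⟩ j = if j = (⟨0, by omega⟩ : Fin N) then 1 else 0) ∧
       (∀ j, M ⟨1, by omega⟩ j = if j = (⟨1, by omega⟩ : Fin N) then 1 else 0)) := by
  have hs : Real.sqrt (E / 2) ≠ 0 := (Real.sqrt_pos.mpr (half_pos hE)).ne'
  have hne : (⟨1, by omega⟩ : Fin N) ≠ ⟨0, by omega⟩ := by simp
  have htr : (fun i => (t0 i).re) = Pi.single (⟨1, by omega⟩ : Fin N) (Real.sqrt (E / 2)) := by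
    funext i
    rw [ht0, Pi.single_apply]
    split_ifs <;> simp_all
  have hti : (fun i => (t0 i).im) = Pi.single (⟨0, by omega⟩ : Fin N) (-Real.sqrt (E / 2)) := by
    funext i
    rw [ht0, Pi.single_apply]
    split_ifs <;> simp
  have hur : (fun i => (u0 i).re) = Pi.single (⟨0, by omega⟩ : Fin N) (Real.sqrt (E / 2)) := by
    funext i
    rw [hu0, Pi.single_apply]
    split_ifs <;> simp
  have hui : (fun i => (u0 i).im) = Pi.single (⟨1, by omega⟩ : Fin N) (Real.sqrt (E / 2)) := by
    funext i
    rw [hu0, Pi.single_apply]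
    split_ifs <;> simp_all
  have hMT : IsUnit Mᵀ.det := by rwa [Matrix.det_transpose]
  rw [map_ofReal_mulVec_eq_self_iff, map_ofReal_mulVec_eq_self_iff, htr, hti, hur, hui,
    nonsing_inv_mulVec_eq_self_iff _ hMT, nonsing_inv_mulVec_eq_self_iff _ hMT,
    mulVec_single_eq_self_iff _ _ hs, mulVec_single_eq_self_iff _ _ (neg_ne_zero.mpr hs),
    mulVec_single_eq_self_iff _ _ hs, mulVec_single_eq_self_iff _ _ hs]
  simp only [Matrix.transpose_apply]
  tauto
end

section
/- Let A be an associative unital ℂ-algebra containing elements a, a⁺, b, b⁺ such that a·a⁺ − a⁺·a = 1, b·b⁺ − b⁺·b = 1, and each of a, a⁺ commutes with each of b, b⁺. Define J₃ = (a⁺·a − b⁺·b)/2, K₊ = ((a⁺)² − b²)/2, K₋ = (a² − (b⁺)²)/2, and 𝓔 = (i/2)·(a⁺·b⁺ − a·b). Then the quadratic Casimir Ĉ = J₃² − (K₊·K₋ + K₋·K₊)/2 satisfies Ĉ = −(𝓔² + 1/4), and Ĉ commutes with J₃, K₊ and K₋. -/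
section CanonicalCommutation

variable {A : Type*} [Ring A] {a ad b bd : A}

theorem mul_reassoc {x y z : A} (h : x * y = z) (w : A) : x * (y * w) = z * w := by
  rw [← mul_assoc, h]

/-- The quadratic Casimir identity, cleared of denominators. -/
theorem two_mul_sq_sub_anticommutator_eq
    (ha : a * ad - ad * a = 1) (hb : b * bd - bd * b = 1)
    (hab : a * b = b * a) (habd : a * bd = bd * a)
    (hadb : ad * b = b * ad) (hadbd : ad * bd = bd * ad) :
    2 * (ad * a - bd * b) ^ 2
      - ((ad ^ 2 - b ^ 2) * (a ^ 2 - bd ^ 2) + (a ^ 2 - bd ^ 2) * (ad ^ 2 - b ^ 2))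
      = 2 * (ad * bd - a * b) ^ 2 - 2 := by
  have ha' := sub_eq_iff_eq_add.mp ha
  have hb' := sub_eq_iff_eq_add.mp hb
  simp only [sq, two_mul, mul_sub, sub_mul, mul_add, add_mul, mul_assoc, one_mul, mul_one,
    ha', hb', ← hab, ← hadbd,
    mul_reassoc ha', mul_reassoc hb', mul_reassoc hab.symm, mul_reassoc habd.symm,
    mul_reassoc hadb.symm, mul_reassoc hadbd.symm]
  rw [← one_add_one_eq_two]
  abel

theorem commute_squeezing_number_sub
    (ha : a * ad - ad * a = 1) (hb : b * bd - bd * b = 1)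
    (hab : a * b = b * a) (habd : a * bd = bd * a)
    (hadb : ad * b = b * ad) (hadbd : ad * bd = bd * ad) :
    Commute (ad * bd - a * b) (ad * a - bd * b) := by
  rw [commute_iff_eq]
  have ha' := sub_eq_iff_eq_add.mp ha
  have hb' := sub_eq_iff_eq_add.mp hb
  simp only [mul_sub, sub_mul, mul_add, add_mul, mul_assoc, one_mul, mul_one,
    hb', ← hab, ← habd, ← hadbd,
    mul_reassoc ha', mul_reassoc hb', mul_reassoc hab.symm, mul_reassoc habd.symm,
    mul_reassoc hadb.symm, mul_reassoc hadbd.symm]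
  abel

theorem commute_squeezing_sq_sub_sq
    (ha : a * ad - ad * a = 1) (hb : b * bd - bd * b = 1)
    (hab : a * b = b * a) (hadb : ad * b = b * ad) (hadbd : ad * bd = bd * ad) :
    Commute (ad * bd - a * b) (ad ^ 2 - b ^ 2) := by
  rw [commute_iff_eq]
  have ha' := sub_eq_iff_eq_add.mp ha
  have hb' := sub_eq_iff_eq_add.mp hb
  simp only [sq, mul_sub, sub_mul, mul_add, add_mul, mul_assoc, one_mul, mul_one,
    hb', ← hadb, ← hadbd, mul_reassoc ha', mul_reassoc hb', mul_reassoc hab.symm,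
    mul_reassoc hadb.symm, mul_reassoc hadbd.symm]
  abel

theorem commute_squeezing_sq_sub_sq'
    (ha : a * ad - ad * a = 1) (hb : b * bd - bd * b = 1)
    (hab : a * b = b * a) (habd : a * bd = bd * a) (hadbd : ad * bd = bd * ad) :
    Commute (ad * bd - a * b) (a ^ 2 - bd ^ 2) := by
  rw [hab, hadbd, ← neg_sub (bd ^ 2)]
  exact (commute_squeezing_sq_sub_sq hb ha hab.symm habd.symm hadbd.symm).neg_right

end CanonicalCommutation

/-- The quadratic Casimir `Ĉ = J₃² − (K₊K₋ + K₋K₊)/2` of the quantized Schwinger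
representation equals `−(𝓔² + 1/4)` with `𝓔 = (i/2)(a⁺b⁺ − ab)`, and it commutes
with `J₃`, `K₊` and `K₋`. -/
theorem stmt_15 (A : Type*) [Ring A] [Algebra ℂ A]
    (a ad b bd : A)
    (ha : a * ad - ad * a = 1)
    (hb : b * bd - bd * b = 1)
    (hab : a * b = b * a) (habd : a * bd = bd * a)
    (hadb : ad * b = b * ad) (hadbd : ad * bd = bd * ad)
    (J₃ Kp Km En C : A)
    (hJ : J₃ = (2 : ℂ)⁻¹ • (ad * a - bd * b))
    (hKp : Kp = (2 : ℂ)⁻¹ • (ad ^ 2 - b ^ 2))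
    (hKm : Km = (2 : ℂ)⁻¹ • (a ^ 2 - bd ^ 2))
    (hEn : En = (Complex.I / 2) • (ad * bd - a * b))
    (hC : C = J₃ ^ 2 - (2 : ℂ)⁻¹ • (Kp * Km + Km * Kp)) :
    C = -(En ^ 2 + (4 : ℂ)⁻¹ • (1 : A)) ∧
    C * J₃ = J₃ * C ∧ C * Kp = Kp * C ∧ C * Km = Km * C := by
  have hCE : C = -(En ^ 2 + (4 : ℂ)⁻¹ • (1 : A)) := by
    have hcas := two_mul_sq_sub_anticommutator_eq ha hb hab habd hadb hadbd
    have hI : (Complex.I / 2) ^ 2 = -(4 : ℂ)⁻¹ := by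
      linear_combination (1 / 4 : ℂ) * Complex.I_sq
    rw [hC, hJ, hKp, hKm, hEn]
    simp only [smul_pow, smul_mul_smul_comm, hI]
    rw [two_mul, two_mul, ← one_add_one_eq_two (R := A)] at hcas
    linear_combination (norm := module) (8 : ℂ)⁻¹ • hcas
  have hcomm {x : A} (hx : Commute (ad * bd - a * b) x) (c : ℂ) :
      C * (c • x) = (c • x) * C := by
    rw [hCE, hEn]
    exact ((((hx.smul_left _).pow_left 2).add_left
      ((Commute.one_left x).smul_left _)).neg_left.smul_right c).eq
  refine ⟨hCE, ?_, ?_, ?_⟩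
  · rw [hJ]
    exact hcomm (commute_squeezing_number_sub ha hb hab habd hadb hadbd) _
  · rw [hKp]
    exact hcomm (commute_squeezing_sq_sub_sq ha hb hab hadb hadbd) _
  · rw [hKm]
    exact hcomm (commute_squeezing_sq_sub_sq' ha hb hab habd hadbd) _
end

section
/- Let A be an associative unital ℂ-algebra containing elements a, a⁺, b, b⁺ such that a·a⁺ − a⁺·a = 1, b·b⁺ − b⁺·b = 1, and each of a, a⁺ commutes with each of b, b⁺. Define 𝓔 = (i/2)·(a⁺·b⁺ − a·b), K₃ = −(a⁺·b⁺ + a·b)/2, and E = (a⁺·a + b⁺·b + 1)/2. Then [𝓔, K₃] = i·E, [𝓔, E] = i·K₃, and consequently [𝓔, K₃ + E] = i·(K₃ + E). In particular, if v is a vector in a module on which A acts with 𝓔·v = s·v for some scalar s, then 𝓔·((K₃ + E)·v) = (s + i)·((K₃ + E)·v). -/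
/-- For two commuting canonical pairs, the commutators among `a⁺b⁺`, `ab` and `a⁺a + b⁺b + 1`. -/
theorem commutators_of_canonical_pairs {A : Type*} [Ring A] {a ad b bd : A}
    (ha : a * ad - ad * a = 1) (hb : b * bd - bd * b = 1)
    (hab : a * b = b * a) (habd : a * bd = bd * a)
    (hadb : ad * b = b * ad) (hadbd : ad * bd = bd * ad) :
    (ad * bd) * (a * b) = (a * b) * (ad * bd) - (ad * a + bd * b + 1) ∧
    (ad * bd) * (ad * a + bd * b + 1) = (ad * a + bd * b + 1) * (ad * bd) - 2 • (ad * bd) ∧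
    (a * b) * (ad * a + bd * b + 1) = (ad * a + bd * b + 1) * (a * b) + 2 • (a * b) := by
  have ha' : a * ad = ad * a + 1 := by rw [← ha]; abel
  have hb' : b * bd = bd * b + 1 := by rw [← hb]; abel
  have ha_assoc (x : A) : a * (ad * x) = ad * (a * x) + x := by
    rw [← mul_assoc, ha', add_mul, one_mul, mul_assoc]
  have hb_assoc (x : A) : b * (bd * x) = bd * (b * x) + x := by
    rw [← mul_assoc, hb', add_mul, one_mul, mul_assoc]
  have hab_assoc (x : A) : b * (a * x) = a * (b * x) := by
    rw [← mul_assoc, ← hab, mul_assoc]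
  have habd_assoc (x : A) : bd * (a * x) = a * (bd * x) := by
    rw [← mul_assoc, ← habd, mul_assoc]
  have hadb_assoc (x : A) : b * (ad * x) = ad * (b * x) := by
    rw [← mul_assoc, ← hadb, mul_assoc]
  have hadbd_assoc (x : A) : bd * (ad * x) = ad * (bd * x) := by
    rw [← mul_assoc, ← hadbd, mul_assoc]
  refine ⟨?_, ?_, ?_⟩ <;>
  · simp only [mul_add, add_mul, mul_one, one_mul, mul_assoc, ha', hb', ← hab, ← habd,
      ← hadbd, ha_assoc, hb_assoc, hab_assoc, habd_assoc, hadb_assoc, hadbd_assoc]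
    abel

/-- The operator `K₃ + E` generates imaginary shifts of the su(1,1) Casimir label:
`[𝓔,K₃] = iE`, `[𝓔,E] = iK₃`, hence `[𝓔, K₃+E] = i(K₃+E)`, and `K₃+E` maps an
`𝓔`-eigenvector of eigenvalue `s` to one of eigenvalue `s + i`. -/
theorem stmt_16 (A : Type*) [Ring A] [Algebra ℂ A]
    (a ad b bd : A)
    (ha : a * ad - ad * a = 1)
    (hb : b * bd - bd * b = 1)
    (hab : a * b = b * a) (habd : a * bd = bd * a)
    (hadb : ad * b = b * ad) (hadbd : ad * bd = bd * ad)
    (En K₃ E : A)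
    (hEn : En = (Complex.I / 2) • (ad * bd - a * b))
    (hK3 : K₃ = -((2 : ℂ)⁻¹ • (ad * bd + a * b)))
    (hE : E = (2 : ℂ)⁻¹ • (ad * a + bd * b + 1)) :
    En * K₃ - K₃ * En = Complex.I • E ∧
    En * E - E * En = Complex.I • K₃ ∧
    En * (K₃ + E) - (K₃ + E) * En = Complex.I • (K₃ + E) ∧
    ∀ (V : Type*) [AddCommGroup V] [Module A V] (v : V) (s : ℂ),
      En • v = algebraMap ℂ A s • v →
      En • ((K₃ + E) • v) = algebraMap ℂ A (s + Complex.I) • ((K₃ + E) • v) := by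
  obtain ⟨hXY, hXN, hYN⟩ := commutators_of_canonical_pairs ha hb hab habd hadb hadbd
  have hEnK : En * K₃ - K₃ * En = Complex.I • E := by
    subst hEn hK3 hE
    generalize ad * a + bd * b + 1 = N at *
    generalize ad * bd = X at *
    generalize a * b = Y at *
    simp only [mul_neg, neg_mul, smul_mul_smul_comm, mul_add, add_mul, mul_sub, sub_mul, hXY]
    module
  have hEnE : En * E - E * En = Complex.I • K₃ := by
    subst hEn hK3 hE
    generalize ad * a + bd * b + 1 = N at *
    generalize ad * bd = X at *
    generalize a * b = Y at *
    simp only [smul_mul_smul_comm, mul_sub, sub_mul, hXN, hYN]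
    module
  have hEnKE : En * (K₃ + E) - (K₃ + E) * En = Complex.I • (K₃ + E) := by
    rw [mul_add, add_mul, add_sub_add_comm, hEnK, hEnE, smul_add, add_comm]
  refine ⟨hEnK, hEnE, hEnKE, fun V _ _ v s hv => ?_⟩
  rw [← mul_smul, sub_eq_iff_eq_add.mp hEnKE, add_smul _ _ v, mul_smul (K₃ + E), hv, ← mul_smul,
    ← Algebra.commutes, Algebra.smul_def, mul_smul, mul_smul, map_add,
    add_smul (algebraMap ℂ A s), add_comm]
end

section
/- Let N ≥ 1 and let A be an associative unital ℂ-algebra containing elements aᵢ, aᵢ⁺, bᵢ, bᵢ⁺ (i = 1,…,N) with [aᵢ, aⱼ⁺] = δᵢⱼ, [bᵢ, bⱼ⁺] = δᵢⱼ, and all other pairs among these generators commuting (in particular every a-type element commutes with every b-type element). Define the deformation operators α^z_{ij} = i·(aᵢ⁺·aⱼ − aᵢ·aⱼ⁺ + δᵢⱼ), α^w_{ij} = i·(bᵢ⁺·bⱼ − bᵢ·bⱼ⁺ + δᵢⱼ), β_{ij} = i·(aᵢ⁺·bⱼ⁺ − aᵢ·bⱼ), and the total su(1,1) generators J₃ =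 Σᵢ (aᵢ⁺aᵢ − bᵢ⁺bᵢ)/2, K₊ = Σᵢ ((aᵢ⁺)² − bᵢ²)/2, K₋ = Σᵢ (aᵢ² − (bᵢ⁺)²)/2. Then for all i, j: [J₃, α^z_{ij}] = [J₃, α^w_{ij}] = [J₃, β_{ij}] = 0, [K₊, α^z_{ij}] = [K₊, α^w_{ij}] = [K₊, β_{ij}] = 0, and [K₋, α^z_{ij}] = [K₋, α^w_{ij}] = [K₋, β_{ij}] = 0. -/
/-- If only the `i`-th term of a sum fails to commute with `x`, the commutator of the rescaled sum
with `x` is the rescaled commutator of that term. -/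
theorem smul_sum_commutator {ι A : Type*} [Fintype ι] [DecidableEq ι] [Ring A] [Algebra ℂ A]
    (c : ℂ) (q : ι → A) (x d : A) (i : ι)
    (h : ∀ k, q k * x - x * q k = if k = i then d else 0) :
    (c • ∑ k, q k) * x - x * (c • ∑ k, q k) = c • d := by
  rw [smul_mul_assoc, mul_smul_comm, ← smul_sub, Finset.sum_mul, Finset.mul_sum,
    ← Finset.sum_sub_distrib]
  simp [h]

/-- Leibniz rule for the commutator in its first argument. -/
theorem mul_commutator {A : Type*} [Ring A] {p q x s t : A}
    (hp : p * x - x * p = s) (hq : q * x - x * q = t) :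
    p * q * x - x * (p * q) = s * q + p * t := by
  rw [← hp, ← hq]; noncomm_ring

/-- Leibniz rule for the commutator in its second argument. -/
theorem commutator_mul {A : Type*} [Ring A] {X y z s t : A}
    (hy : X * y - y * X = s) (hz : X * z - z * X = t) :
    X * (y * z) - y * z * X = s * z + y * t := by
  rw [← hy, ← hz]; noncomm_ring

theorem commutator_sub {A : Type*} [Ring A] {X y z s t : A}
    (hy : X * y - y * X = s) (hz : X * z - z * X = t) :
    X * (y - z) - (y - z) * X = s - t := by
  rw [← hy, ← hz]; noncomm_ring

theorem sub_commutator {A : Type*} [Ring A] {y z x s t : A}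
    (hy : y * x - x * y = s) (hz : z * x - x * z = t) :
    (y - z) * x - x * (y - z) = s - t := by
  rw [← hy, ← hz]; noncomm_ring

theorem commutator_smul_eq_zero {A : Type*} [Ring A] [Algebra ℂ A] {X y : A} (c : ℂ)
    (h : X * y - y * X = 0) : X * (c • y) - (c • y) * X = 0 := by
  rw [mul_smul_comm, smul_mul_assoc, ← smul_sub, h, smul_zero]

/-- The quantized deformation operators `α^z_{ij}`, `α^w_{ij}`, `β_{ij}` of `N` pairs
of harmonic oscillators commute with the total su(1,1) generators `J₃`, `K₊`, `K₋`:
they act on the space of SU(1,1) intertwiners. -/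
theorem stmt_17 (N : ℕ) (hN : 1 ≤ N) (A : Type*) [Ring A] [Algebra ℂ A]
    (a ad b bd : Fin N → A)
    (haad : ∀ i j, a i * ad j - ad j * a i = if i = j then 1 else 0)
    (hbbd : ∀ i j, b i * bd j - bd j * b i = if i = j then 1 else 0)
    (haa : ∀ i j, a i * a j = a j * a i)
    (hadad : ∀ i j, ad i * ad j = ad j * ad i)
    (hbb : ∀ i j, b i * b j = b j * b i)
    (hbdbd : ∀ i j, bd i * bd j = bd j * bd i)
    (hab : ∀ i j, a i * b j = b j * a i)
    (habd : ∀ i j, a i * bd j = bd j * a i)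
    (hadb : ∀ i j, ad i * b j = b j * ad i)
    (hadbd : ∀ i j, ad i * bd j = bd j * ad i)
    (αz αw β : Fin N → Fin N → A)
    (hαz : ∀ i j, αz i j = Complex.I • (ad i * a j - a i * ad j + if i = j then 1 else 0))
    (hαw : ∀ i j, αw i j = Complex.I • (bd i * b j - b i * bd j + if i = j then 1 else 0))
    (hβ : ∀ i j, β i j = Complex.I • (ad i * bd j - a i * b j))
    (J₃ Kp Km : A)
    (hJ : J₃ = (2 : ℂ)⁻¹ • ∑ i, (ad i * a i - bd i * b i))
    (hKp : Kp = (2 : ℂ)⁻¹ • ∑ i, ((ad i) ^ 2 - (b i) ^ 2))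
    (hKm : Km = (2 : ℂ)⁻¹ • ∑ i, ((a i) ^ 2 - (bd i) ^ 2)) :
    ∀ i j,
      (J₃ * αz i j - αz i j * J₃ = 0) ∧
      (J₃ * αw i j - αw i j * J₃ = 0) ∧
      (J₃ * β i j - β i j * J₃ = 0) ∧
      (Kp * αz i j - αz i j * Kp = 0) ∧
      (Kp * αw i j - αw i j * Kp = 0) ∧
      (Kp * β i j - β i j * Kp = 0) ∧
      (Km * αz i j - αz i j * Km = 0) ∧
      (Km * αw i j - αw i j * Km = 0) ∧
      (Km * β i j - β i j * Km = 0) := by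
  have hada : ∀ i j, ad j * a i - a i * ad j = if j = i then -1 else 0 := by
    intro i j
    rw [← neg_sub, haad]
    by_cases h : i = j
    · simp [h]
    · simp [h, Ne.symm h]
  have hbdb : ∀ i j, bd j * b i - b i * bd j = if j = i then -1 else 0 := by
    intro i j
    rw [← neg_sub, hbbd]
    by_cases h : i = j
    · simp [h]
    · simp [h, Ne.symm h]
  have hJ₃_a : ∀ i, J₃ * a i - a i * J₃ = (-(2 : ℂ)⁻¹) • a i := by
    intro i
    rw [hJ, smul_sum_commutator _ _ _ ((-1 : ℂ) • a i) i]
    · module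
    · intro k
      rw [sub_commutator (mul_commutator (hada i k) (sub_eq_zero.2 (haa k i)))
        (mul_commutator (sub_eq_zero.2 (habd i k).symm) (sub_eq_zero.2 (hab i k).symm))]
      split_ifs with h
      · subst h
        simp
      · simp
  have hJ₃_ad : ∀ i, J₃ * ad i - ad i * J₃ = (2 : ℂ)⁻¹ • ad i := by
    intro i
    rw [hJ, smul_sum_commutator _ _ _ ((1 : ℂ) • ad i) i]
    · module
    · intro k
      rw [sub_commutator (mul_commutator (sub_eq_zero.2 (hadad k i)) (haad k i))
        (mul_commutator (sub_eq_zero.2 (hadbd i k).symm) (sub_eq_zero.2 (hadb i k).symm))]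
      split_ifs with h
      · subst h
        simp
      · simp
  have hJ₃_b : ∀ i, J₃ * b i - b i * J₃ = (2 : ℂ)⁻¹ • b i := by
    intro i
    rw [hJ, smul_sum_commutator _ _ _ ((1 : ℂ) • b i) i]
    · module
    · intro k
      rw [sub_commutator (mul_commutator (sub_eq_zero.2 (hadb k i)) (sub_eq_zero.2 (hab k i)))
        (mul_commutator (hbdb i k) (sub_eq_zero.2 (hbb k i)))]
      split_ifs with h
      · subst h
        simp
      · simp
  have hJ₃_bd : ∀ i, J₃ * bd i - bd i * J₃ = (-(2 : ℂ)⁻¹) • bd i := by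
    intro i
    rw [hJ, smul_sum_commutator _ _ _ ((-1 : ℂ) • bd i) i]
    · module
    · intro k
      rw [sub_commutator (mul_commutator (sub_eq_zero.2 (hadbd k i)) (sub_eq_zero.2 (habd k i)))
        (mul_commutator (sub_eq_zero.2 (hbdbd k i)) (hbbd k i))]
      split_ifs with h
      · subst h
        simp
      · simp
  have hKp_a : ∀ i, Kp * a i - a i * Kp = (-1 : ℂ) • ad i := by
    intro i
    rw [hKp, smul_sum_commutator _ _ _ ((-2 : ℂ) • ad i) i]
    · module
    · intro k
      rw [pow_two, pow_two,
        sub_commutator (mul_commutator (hada i k) (hada i k))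
        (mul_commutator (sub_eq_zero.2 (hab i k).symm) (sub_eq_zero.2 (hab i k).symm))]
      split_ifs with h
      · subst h
        simp [two_smul]
      · simp
  have hKp_ad : ∀ i, Kp * ad i - ad i * Kp = (0 : ℂ) • ad i := by
    intro i
    rw [hKp, smul_sum_commutator _ _ _ ((0 : ℂ) • ad i) i]
    · module
    · intro k
      rw [pow_two, pow_two,
        sub_commutator (mul_commutator (sub_eq_zero.2 (hadad k i)) (sub_eq_zero.2 (hadad k i)))
        (mul_commutator (sub_eq_zero.2 (hadb i k).symm) (sub_eq_zero.2 (hadb i k).symm))]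
      split_ifs with h
      · subst h
        simp
      · simp
  have hKp_b : ∀ i, Kp * b i - b i * Kp = (0 : ℂ) • b i := by
    intro i
    rw [hKp, smul_sum_commutator _ _ _ ((0 : ℂ) • b i) i]
    · module
    · intro k
      rw [pow_two, pow_two,
        sub_commutator (mul_commutator (sub_eq_zero.2 (hadb k i)) (sub_eq_zero.2 (hadb k i)))
        (mul_commutator (sub_eq_zero.2 (hbb k i)) (sub_eq_zero.2 (hbb k i)))]
      split_ifs with h
      · subst h
        simp
      · simp
  have hKp_bd : ∀ i, Kp * bd i - bd i * Kp = (-1 : ℂ) • b i := by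
    intro i
    rw [hKp, smul_sum_commutator _ _ _ ((-2 : ℂ) • b i) i]
    · module
    · intro k
      rw [pow_two, pow_two,
        sub_commutator (mul_commutator (sub_eq_zero.2 (hadbd k i)) (sub_eq_zero.2 (hadbd k i)))
        (mul_commutator (hbbd k i) (hbbd k i))]
      split_ifs with h
      · subst h
        simp [two_smul]
      · simp
  have hKm_a : ∀ i, Km * a i - a i * Km = (0 : ℂ) • a i := by
    intro i
    rw [hKm, smul_sum_commutator _ _ _ ((0 : ℂ) • a i) i]
    · module
    · intro k
      rw [pow_two, pow_two,
        sub_commutator (mul_commutator (sub_eq_zero.2 (haa k i)) (sub_eq_zero.2 (haa k i)))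
        (mul_commutator (sub_eq_zero.2 (habd i k).symm) (sub_eq_zero.2 (habd i k).symm))]
      split_ifs with h
      · subst h
        simp
      · simp
  have hKm_ad : ∀ i, Km * ad i - ad i * Km = (1 : ℂ) • a i := by
    intro i
    rw [hKm, smul_sum_commutator _ _ _ ((2 : ℂ) • a i) i]
    · module
    · intro k
      rw [pow_two, pow_two,
        sub_commutator (mul_commutator (haad k i) (haad k i))
        (mul_commutator (sub_eq_zero.2 (hadbd i k).symm) (sub_eq_zero.2 (hadbd i k).symm))]
      split_ifs with h
      · subst h
        simp [two_smul]
      · simp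
  have hKm_b : ∀ i, Km * b i - b i * Km = (1 : ℂ) • bd i := by
    intro i
    rw [hKm, smul_sum_commutator _ _ _ ((2 : ℂ) • bd i) i]
    · module
    · intro k
      rw [pow_two, pow_two,
        sub_commutator (mul_commutator (sub_eq_zero.2 (hab k i)) (sub_eq_zero.2 (hab k i)))
        (mul_commutator (hbdb i k) (hbdb i k))]
      split_ifs with h
      · subst h
        simp [two_smul]
      · simp
  have hKm_bd : ∀ i, Km * bd i - bd i * Km = (0 : ℂ) • bd i := by
    intro i
    rw [hKm, smul_sum_commutator _ _ _ ((0 : ℂ) • bd i) i]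
    · module
    · intro k
      rw [pow_two, pow_two,
        sub_commutator (mul_commutator (sub_eq_zero.2 (habd k i)) (sub_eq_zero.2 (habd k i)))
        (mul_commutator (sub_eq_zero.2 (hbdbd k i)) (sub_eq_zero.2 (hbdbd k i)))]
      split_ifs with h
      · subst h
        simp
      · simp
  have hz : ∀ i j, αz i j = Complex.I • (ad i * a j - ad j * a i) := by
    intro i j
    rw [hαz, ← haad i j]
    congr 1
    abel
  have hw : ∀ i j, αw i j = Complex.I • (bd i * b j - bd j * b i) := by
    intro i j
    rw [hαw, ← hbbd i j]
    congr 1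
    abel
  intro i j
  rw [hz, hw, hβ]
  refine ⟨?_, ?_, ?_, ?_, ?_, ?_, ?_, ?_, ?_⟩ <;> apply commutator_smul_eq_zero
  · rw [commutator_sub (commutator_mul (hJ₃_ad i) (hJ₃_a j))
      (commutator_mul (hJ₃_ad j) (hJ₃_a i))]
    simp
  · rw [commutator_sub (commutator_mul (hJ₃_bd i) (hJ₃_b j))
      (commutator_mul (hJ₃_bd j) (hJ₃_b i))]
    simp
  · rw [commutator_sub (commutator_mul (hJ₃_ad i) (hJ₃_bd j))
      (commutator_mul (hJ₃_a i) (hJ₃_b j))]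
    simp
  · rw [commutator_sub (commutator_mul (hKp_ad i) (hKp_a j))
      (commutator_mul (hKp_ad j) (hKp_a i))]
    simp [hadad i j]
  · rw [commutator_sub (commutator_mul (hKp_bd i) (hKp_b j))
      (commutator_mul (hKp_bd j) (hKp_b i))]
    simp [hbb i j]
  · rw [commutator_sub (commutator_mul (hKp_ad i) (hKp_bd j))
      (commutator_mul (hKp_a i) (hKp_b j))]
    simp [hadb i j]
  · rw [commutator_sub (commutator_mul (hKm_ad i) (hKm_a j))
      (commutator_mul (hKm_ad j) (hKm_a i))]
    simp [haa i j]
  · rw [commutator_sub (commutator_mul (hKm_bd i) (hKm_b j))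
      (commutator_mul (hKm_bd j) (hKm_b i))]
    simp [hbdbd i j]
  · rw [commutator_sub (commutator_mul (hKm_ad i) (hKm_bd j))
      (commutator_mul (hKm_a i) (hKm_b j))]
    simp
end

section
/- Let N ≥ 1 and let A be an associative unital ℂ-algebra containing elements aᵢ, aᵢ⁺, bᵢ, bᵢ⁺ (i = 1,…,N) with [aᵢ, aⱼ⁺] = δᵢⱼ, [bᵢ, bⱼ⁺] = δᵢⱼ, and all other pairs among these generators commuting. Define α^z_{ij} = i·(aᵢ⁺·aⱼ − aᵢ·aⱼ⁺ + δᵢⱼ), α^w_{ij} = i·(bᵢ⁺·bⱼ − bᵢ·bⱼ⁺ + δᵢⱼ), β_{ij} = i·(aᵢ⁺·bⱼ⁺ − aᵢ·bⱼ). Then for all indices i,j,k,l: (1) [α^z_{ij}, α^z_{kl}] = i·(δ_{jk}α^z_{il} − δ_{ik}α^z_{jl} − δ_{jl}α^z_{ik} + δ_{il}α^z_{jk}); (2) [α^w_{ij}, α^w_{kl}] = i·(δ_{jk}α^w_{il} − δ_{ik}α^w_{jl} − δ_{jl}α^w_{ik} + δ_{il}α^w_{jk}); (3) [α^z_{ij},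 α^w_{kl}] = 0; (4) [β_{ij}, β_{kl}] = i·(δ_{jl}α^z_{ik} + δ_{ik}α^w_{jl}); (5) [α^z_{ij}, β_{kl}] = i·(δ_{jk}β_{il} − δ_{ik}β_{jl}); (6) [α^w_{ij}, β_{kl}] = i·(δ_{jl}β_{ki} − δ_{il}β_{kj}). -/
section Oscillators

variable {A ι : Type*} [Ring A]

theorem commutator_mul_s18 (x y z : A) :
    x * (y * z) - y * z * x = (x * y - y * x) * z + y * (x * z - z * x) := by
  noncomm_ring

variable {c cd : ι → A}

/-- The antisymmetric combination of creation and annihilation operators. -/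
def soGenerator (c cd : ι → A) (i j : ι) : A := cd i * c j - cd j * c i

theorem commute_soGenerator {x : A} (hc : ∀ i, c i * x = x * c i) (hd : ∀ i, cd i * x = x * cd i)
    (i j : ι) : Commute (soGenerator c cd i j) x :=
  (Commute.mul_left (hd i) (hc j)).sub_left (Commute.mul_left (hd j) (hc i))

theorem smul_I_commutator [Algebra ℂ A] (x y : A) :
    (Complex.I • x) * (Complex.I • y) - (Complex.I • y) * (Complex.I • x) =
      -(x * y - y * x) := by
  simp only [smul_mul_smul_comm, Complex.I_mul_I, neg_smul, one_smul]
  abel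

variable [DecidableEq ι]

theorem soGenerator_eq (h : ∀ i j, c i * cd j - cd j * c i = if i = j then 1 else 0) (i j : ι) :
    cd i * c j - c i * cd j + (if i = j then 1 else 0) = soGenerator c cd i j := by
  rw [← h i j, soGenerator]
  abel

theorem commutator_soGenerator_creation
    (h : ∀ i j, c i * cd j - cd j * c i = if i = j then 1 else 0)
    (hd : ∀ i j, cd i * cd j = cd j * cd i) (i j k : ι) :
    soGenerator c cd i j * cd k - cd k * soGenerator c cd i j =
      (if j = k then cd i else 0) - (if i = k then cd j else 0) := by
  have e : soGenerator c cd i j * cd k - cd k * soGenerator c cd i j =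
      cd i * (c j * cd k - cd k * c j) - cd j * (c i * cd k - cd k * c i)
        + (cd i * cd k - cd k * cd i) * c j - (cd j * cd k - cd k * cd j) * c i := by
    rw [soGenerator]; noncomm_ring
  rw [e, h, h, hd i k, hd j k]
  simp

theorem commutator_soGenerator_annihilation
    (h : ∀ i j, c i * cd j - cd j * c i = if i = j then 1 else 0)
    (hc : ∀ i j, c i * c j = c j * c i) (i j k : ι) :
    soGenerator c cd i j * c k - c k * soGenerator c cd i j =
      (if j = k then c i else 0) - (if i = k then c j else 0) := by
  have e : soGenerator c cd i j * c k - c k * soGenerator c cd i j =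
      (c k * cd j - cd j * c k) * c i - (c k * cd i - cd i * c k) * c j
        + cd i * (c j * c k - c k * c j) - cd j * (c i * c k - c k * c i) := by
    rw [soGenerator]; noncomm_ring
  rw [e, h, h, hc i k, hc j k]
  simp [eq_comm]

theorem commutator_soGenerator_soGenerator
    (h : ∀ i j, c i * cd j - cd j * c i = if i = j then 1 else 0)
    (hc : ∀ i j, c i * c j = c j * c i) (hd : ∀ i j, cd i * cd j = cd j * cd i) (i j k l : ι) :
    soGenerator c cd i j * soGenerator c cd k l - soGenerator c cd k l * soGenerator c cd i j =
      (if j = k then soGenerator c cd i l else 0) - (if i = k then soGenerator c cd j l else 0)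
        - (if j = l then soGenerator c cd i k else 0)
        + (if i = l then soGenerator c cd j k else 0) := by
  have e (R : A) : R * soGenerator c cd k l - soGenerator c cd k l * R =
      (R * (cd k * c l) - cd k * c l * R) - (R * (cd l * c k) - cd l * c k * R) := by
    rw [soGenerator]; noncomm_ring
  rw [e]
  simp only [commutator_mul_s18, commutator_soGenerator_creation h hd,
    commutator_soGenerator_annihilation h hc]
  simp only [soGenerator]
  split_ifs <;> noncomm_ring

end Oscillators


/-- Commutation relations of the quantized deformation operators: the `α^z`'s and
`α^w`'s form two commuting so(N) algebras and close with the `β`'s into a larger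
Lie algebra. -/
theorem stmt_18 (N : ℕ) (hN : 1 ≤ N) (A : Type*) [Ring A] [Algebra ℂ A]
    (a ad b bd : Fin N → A)
    (haad : ∀ i j, a i * ad j - ad j * a i = if i = j then 1 else 0)
    (hbbd : ∀ i j, b i * bd j - bd j * b i = if i = j then 1 else 0)
    (haa : ∀ i j, a i * a j = a j * a i)
    (hadad : ∀ i j, ad i * ad j = ad j * ad i)
    (hbb : ∀ i j, b i * b j = b j * b i)
    (hbdbd : ∀ i j, bd i * bd j = bd j * bd i)
    (hab : ∀ i j, a i * b j = b j * a i)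
    (habd : ∀ i j, a i * bd j = bd j * a i)
    (hadb : ∀ i j, ad i * b j = b j * ad i)
    (hadbd : ∀ i j, ad i * bd j = bd j * ad i)
    (αz αw β : Fin N → Fin N → A)
    (hαz : ∀ i j, αz i j = Complex.I • (ad i * a j - a i * ad j + if i = j then 1 else 0))
    (hαw : ∀ i j, αw i j = Complex.I • (bd i * b j - b i * bd j + if i = j then 1 else 0))
    (hβ : ∀ i j, β i j = Complex.I • (ad i * bd j - a i * b j)) :
    ∀ i j k l,
      (αz i j * αz k l - αz k l * αz i j = Complex.I •
        ((if j = k then αz i l else 0) - (if i = k then αz j l else 0)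
          - (if j = l then αz i k else 0) + (if i = l then αz j k else 0))) ∧
      (αw i j * αw k l - αw k l * αw i j = Complex.I •
        ((if j = k then αw i l else 0) - (if i = k then αw j l else 0)
          - (if j = l then αw i k else 0) + (if i = l then αw j k else 0))) ∧
      (αz i j * αw k l - αw k l * αz i j = 0) ∧
      (β i j * β k l - β k l * β i j = Complex.I •
        ((if j = l then αz i k else 0) + (if i = k then αw j l else 0))) ∧
      (αz i j * β k l - β k l * αz i j = Complex.I •
        ((if j = k then β i l else 0) - (if i = k then β j l else 0))) ∧
      (αw i j * β k l - β k l * αw i j = Complex.I •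
        ((if j = l then β k i else 0) - (if i = l then β k j else 0))) := by
  intro i j k l
  have I_ite (p : Prop) [Decidable p] (x : A) :
      (if p then Complex.I • x else 0) = Complex.I • (if p then x else 0) := by
    split_ifs <;> simp
  have neg_eq (x : A) : Complex.I • Complex.I • x = -x := by
    rw [smul_smul, Complex.I_mul_I, neg_one_smul]
  have key (x y z : A) (h : x * y - y * x = z) :
      (Complex.I • x) * (Complex.I • y) - (Complex.I • y) * (Complex.I • x) =
        Complex.I • Complex.I • z := by
    rw [smul_I_commutator, neg_eq, h]
  simp only [soGenerator_eq haad] at hαz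
  simp only [soGenerator_eq hbbd] at hαw
  simp only [hαz, hαw, hβ, I_ite, ← smul_sub, ← smul_add]
  have hzb (m : Fin N) := commute_soGenerator (c := a) (cd := ad) (x := b m)
    (fun i => hab i m) (fun i => hadb i m) i j
  have hzbd (m : Fin N) := commute_soGenerator (c := a) (cd := ad) (x := bd m)
    (fun i => habd i m) (fun i => hadbd i m) i j
  have hwa (m : Fin N) := commute_soGenerator (c := b) (cd := bd) (x := a m)
    (fun i => (hab m i).symm) (fun i => (habd m i).symm) i j
  have hwad (m : Fin N) := commute_soGenerator (c := b) (cd := bd) (x := ad m)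
    (fun i => (hadb m i).symm) (fun i => (hadbd m i).symm) i j
  have split (R x y : A) : R * (x - y) - (x - y) * R = (R * x - x * R) - (R * y - y * R) := by
    noncomm_ring
  refine ⟨key _ _ _ (commutator_soGenerator_soGenerator haad haa hadad i j k l),
    key _ _ _ (commutator_soGenerator_soGenerator hbbd hbb hbdbd i j k l), ?_,
    key _ _ _ ?_, key _ _ _ ?_, key _ _ _ ?_⟩
  · have hz : Commute (soGenerator a ad i j) (soGenerator b bd k l) :=
      ((hzbd k).mul_right (hzb l)).sub_right ((hzbd l).mul_right (hzb k))
    rw [smul_I_commutator, hz.eq, sub_self, neg_zero]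
  · have mixed (i j k l : Fin N) : a i * b j * (ad k * bd l) - ad k * bd l * (a i * b j) =
        (if j = l then a i * ad k else 0) + (if i = k then bd l * b j else 0) := by
      have e : a i * b j * (ad k * bd l) - ad k * bd l * (a i * b j) =
          a i * ad k * (b j * bd l - bd l * b j) + (a i * ad k - ad k * a i) * (bd l * b j) := by
        have h₁ : a i * b j * (ad k * bd l) = a i * ad k * (b j * bd l) := by
          rw [mul_assoc, ← mul_assoc (b j), ← hadb k j]; noncomm_ring
        have h₂ : ad k * bd l * (a i * b j) = ad k * a i * (bd l * b j) := by
          rw [mul_assoc, ← mul_assoc (bd l), ← habd i l]; noncomm_ring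
        rw [h₁, h₂]; noncomm_ring
      rw [e, hbbd, haad]
      simp
    have haa' : a i * b j * (a k * b l) = a k * b l * (a i * b j) :=
      ((Commute.mul_right (haa i k) (hab i l)).mul_left
        (Commute.mul_right (hab k j).symm (hbb j l))).eq
    have hdd' : ad i * bd j * (ad k * bd l) = ad k * bd l * (ad i * bd j) :=
      ((Commute.mul_right (hadad i k) (hadbd i l)).mul_left
        (Commute.mul_right (hadbd k j).symm (hbdbd j l))).eq
    have e : (ad i * bd j - a i * b j) * (ad k * bd l - a k * b l) -
        (ad k * bd l - a k * b l) * (ad i * bd j - a i * b j) =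
        (a k * b l * (ad i * bd j) - ad i * bd j * (a k * b l)) -
          (a i * b j * (ad k * bd l) - ad k * bd l * (a i * b j)) := by
      simp only [sub_mul, mul_sub, haa', hdd']
      abel
    rw [e, mixed, mixed, ← soGenerator_eq haad i k, soGenerator]
    have hki : a k * ad i = ad i * a k + if i = k then 1 else 0 := by
      rw [← sub_eq_iff_eq_add', haad]
      simp only [eq_comm]
    simp only [hki, eq_comm (a := l) (b := j), eq_comm (a := k) (b := i)]
    split_ifs <;> abel
  · rw [split]
    simp only [commutator_mul_s18, commutator_soGenerator_creation haad hadad,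
      commutator_soGenerator_annihilation haad haa, (hzb _).eq, (hzbd _).eq]
    split_ifs <;> noncomm_ring
  · rw [split]
    simp only [commutator_mul_s18, commutator_soGenerator_creation hbbd hbdbd,
      commutator_soGenerator_annihilation hbbd hbb, (hwa _).eq, (hwad _).eq]
    split_ifs <;> noncomm_ring
end
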